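/- arXiv:2406.19725 — 9 statements merged into one kernel-verified Lean document; each statement's English description precedes it below -/
import Mathlib

section
/- Let n ≥ 2 be a natural number. In the ZMod n-module ZMod n, the element 1 is nilpotent (i.e., 1 ∈ Nil_{ZMod n}(ZMod n)) if and only if n is not squarefree. -/
/-- An element `m` of a left `R`-module `M` is nilpotent if `m = 0` or there are `r : R`
and `k : ℕ` with `r ^ k • m = 0` but `r • m ≠ 0`. -/
def IsNilElem (R : Type*) {M : Type*} [Ring R] [AddCommGroup M] [Module R M] (m : M) : Prop :=
  m = 0 ∨ ∃ (r : R) (k : ℕ), r ^ k • m = 0 ∧ r • m ≠ 0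

theorem one_nilElem_zmod_iff_not_squarefree (n : ℕ) (hn : 2 ≤ n) :
    IsNilElem (ZMod n) (1 : ZMod n) ↔ ¬ Squarefree n := by
  have h : Squarefree n ↔ IsReduced (ZMod n) := by
    rw [isReduced_zmod]
    constructor
    · exact Or.inl
    · rintro (h | h)
      · exact h
      · omega
  haveI : Fact (1 < n) := ⟨hn⟩
  rw [h, isReduced_iff]
  push Not
  unfold IsNilElem
  simp only [smul_eq_mul, mul_one]
  constructor
  · rintro (h | ⟨r, k, h1, h2⟩)
    · exact absurd h one_ne_zero
    · exact ⟨r, ⟨k, h1⟩, h2⟩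
  · rintro ⟨r, ⟨k, h1⟩, h2⟩
    exact Or.inr ⟨r, k, h1, h2⟩
end

section
/- Let p be a prime and n ≥ 2 a natural number. In the ZMod (p^n)-module ZMod (p^n), the element p^(n-1) (the image of the integer p^(n-1) in ZMod (p^n)) is not nilpotent, i.e., p^(n-1) ∉ Nil_{ZMod (p^n)}(ZMod (p^n)). -/
theorem pPow_not_nilElem_zmod (p n : ℕ) (hp : p.Prime) (hn : 2 ≤ n) :
    ¬ IsNilElem (ZMod (p ^ n)) (((p ^ (n - 1) : ℕ) : ZMod (p ^ n))) := by
  obtain ⟨m, rfl⟩ : ∃ m, n = m + 1 := ⟨n - 1, by omega⟩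
  haveI : NeZero (p ^ (m + 1)) := ⟨pow_ne_zero _ hp.ne_zero⟩
  have hpos : 0 < p ^ m := pow_pos hp.pos m
  have key : ∀ a : ℕ, ((a : ZMod (p ^ (m + 1))) * ((p ^ m : ℕ) : ZMod (p ^ (m + 1))) = 0) ↔
      p ∣ a := by
    intro a
    rw [← Nat.cast_mul, ZMod.natCast_eq_zero_iff, pow_succ', Nat.mul_dvd_mul_iff_right hpos]
  rw [Nat.add_sub_cancel]
  rintro (h | ⟨r, k, h1, h2⟩)
  · have := (key 1).1 (by rw [h, mul_zero])
    exact hp.one_lt.ne' (Nat.dvd_one.1 this)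
  · obtain ⟨a, rfl⟩ := ZMod.natCast_zmod_surjective r
    rw [smul_eq_mul, ← Nat.cast_pow, key] at h1
    rw [smul_eq_mul, Ne, key] at h2
    exact h2 (hp.dvd_of_dvd_pow h1)
end

section
/- Let p be a prime and n ≥ 2 a natural number. Then ZMod (p^n), regarded as a module over itself, is not nil-semicommutative. -/
/-- A left `R`-module `M` is nil-semicommutative if whenever `a • m` is a nilpotent element
of `M`, so is `a • r • m` for every `r : R`. -/
def IsNilSemicommutative (R M : Type*) [Ring R] [AddCommGroup M] [Module R M] : Prop :=
  ∀ (a : R) (m : M), IsNilElem R (a • m) → ∀ r : R, IsNilElem R (a • r • m)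

theorem zmod_pPow_not_nilSemicommutative (p n : ℕ) (hp : p.Prime) (hn : 2 ≤ n) :
    ¬ IsNilSemicommutative (ZMod (p ^ n)) (ZMod (p ^ n)) := by
  intro h
  have : NeZero (p ^ n) := ⟨(pow_pos hp.pos n).ne'⟩
  obtain ⟨m, rfl⟩ : ∃ m, n = m + 1 := ⟨n - 1, by omega⟩
  have h1 : IsNilElem (ZMod (p ^ (m + 1))) ((1 : ZMod (p ^ (m + 1))) • (1 : ZMod (p ^ (m + 1)))) := by
    refine Or.inr ⟨((p : ℕ) : ZMod (p ^ (m + 1))), m + 1, ?_, ?_⟩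
    · simp only [smul_eq_mul, mul_one]
      rw [← Nat.cast_pow, ZMod.natCast_self]
    · simp only [smul_eq_mul, mul_one]
      rw [Ne, ZMod.natCast_eq_zero_iff]
      intro hd
      have h2 : p ^ (m + 1) ∣ p ^ 1 := by simpa using hd
      have := (Nat.pow_dvd_pow_iff_le_right hp.one_lt).1 h2
      omega
  have hne : ¬ p ^ (m + 1) ∣ p ^ m := by
    intro hd
    have := (Nat.pow_dvd_pow_iff_le_right hp.one_lt).1 hd
    omega
  rcases h 1 1 h1 ((p ^ m : ℕ) : ZMod (p ^ (m + 1))) with h0 | ⟨r, k, hk, hr⟩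
  · simp only [smul_eq_mul, mul_one, one_mul] at h0
    exact hne ((ZMod.natCast_eq_zero_iff _ _).1 h0)
  · obtain ⟨x, rfl⟩ := ZMod.natCast_zmod_surjective r
    simp only [smul_eq_mul, mul_one, one_mul] at hk hr
    rw [← Nat.cast_pow, ← Nat.cast_mul, ZMod.natCast_eq_zero_iff, pow_succ'] at hk
    have h3 : p ∣ x ^ k := Nat.dvd_of_mul_dvd_mul_right (pow_pos hp.pos m) hk
    have h4 : p ∣ x := hp.dvd_of_dvd_pow h3
    apply hr
    rw [← Nat.cast_mul, ZMod.natCast_eq_zero_iff, pow_succ']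
    exact Nat.mul_dvd_mul_right h4 _
end

section
/- Let p be a prime and n ≥ 2 a natural number, and let T be the subring of Matrix (Fin n) (Fin n) (ZMod (p^n)) consisting of the upper triangular matrices (those A with A i j = 0 whenever j < i). Then T, regarded as a left module over itself, is not nil-semicommutative: there exist A, K ∈ T with A * K ∈ Nil_T(T) but A * L * K ∉ Nil_T(T) for some L ∈ T. -/
/-- The subring of upper triangular `n × n` matrices over a ring `α`:
those matrices `A` with `A i j = 0` whenever `j < i`. -/
def upperTriangularSubring (n : ℕ) (α : Type*) [CommRing α] :
    Subring (Matrix (Fin n) (Fin n) α) where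
  carrier := {A | A.BlockTriangular id}
  zero_mem' := Matrix.blockTriangular_zero
  one_mem' := Matrix.blockTriangular_one
  add_mem' := Matrix.BlockTriangular.add
  neg_mem' := Matrix.BlockTriangular.neg
  mul_mem' := Matrix.BlockTriangular.mul

theorem upperTriangular_zmod_pPow_not_nilSemicommutative (p n : ℕ) (hp : p.Prime) (hn : 2 ≤ n) :
    ∃ A K : upperTriangularSubring n (ZMod (p ^ n)),
      IsNilElem (upperTriangularSubring n (ZMod (p ^ n))) (A * K) ∧
        ∃ L : upperTriangularSubring n (ZMod (p ^ n)),
          ¬ IsNilElem (upperTriangularSubring n (ZMod (p ^ n))) (A * L * K) := by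
  classical
  set i : Fin n := ⟨0, by omega⟩ with hi
  set j : Fin n := ⟨1, by omega⟩ with hj
  have hij : i ≠ j := by simp [hi, hj]
  have hlt : i ≤ j := by simp [hi, hj]
  have mem : ∀ (a b : Fin n) (c : ZMod (p ^ n)), a ≤ b →
      Matrix.single a b c ∈ upperTriangularSubring n (ZMod (p ^ n)) := by
    intro a b c hab x y hxy
    rw [Matrix.single_apply, if_neg]
    rintro ⟨rfl, rfl⟩
    exact absurd hab (not_le.mpr hxy)
  have key : ∀ x : ZMod (p ^ n), x * (p : ZMod (p ^ n)) ^ (n - 1) = 0 ↔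
      p ∣ x.val := by
    intro x
    haveI : NeZero (p ^ n) := ⟨pow_ne_zero _ hp.ne_zero⟩
    have h1 : x * (p : ZMod (p ^ n)) ^ (n - 1) = ((x.val * p ^ (n - 1) : ℕ) : ZMod (p ^ n)) := by
      push_cast
      rw [ZMod.natCast_zmod_val]
    have h2 : p ^ n = p * p ^ (n - 1) := by
      rw [← pow_succ']; congr 1; omega
    rw [h1, ZMod.natCast_eq_zero_iff]
    conv_lhs => lhs; rw [h2]
    exact Nat.mul_dvd_mul_iff_right (pow_pos hp.pos _)
  have key2 : ∀ (x : ZMod (p ^ n)) (k : ℕ), x ^ k * (p : ZMod (p ^ n)) ^ (n - 1) = 0 →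
      x * (p : ZMod (p ^ n)) ^ (n - 1) = 0 := by
    intro x k h
    haveI : NeZero (p ^ n) := ⟨pow_ne_zero _ hp.ne_zero⟩
    rw [key] at h ⊢
    have hc : ((x ^ k : ZMod (p ^ n)).val : ZMod p) = ((x.val : ℕ) : ZMod p) ^ k := by
      have hd : p ∣ p ^ n := dvd_pow_self p (by omega)
      have := map_pow (ZMod.castHom hd (ZMod p)) x k
      simpa [ZMod.castHom_apply, ZMod.natCast_val] using this
    haveI : Fact p.Prime := ⟨hp⟩
    rw [← ZMod.natCast_eq_zero_iff] at h ⊢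
    rw [hc] at h
    exact eq_zero_of_pow_eq_zero h
  refine ⟨⟨_, mem i i ((p : ZMod (p ^ n)) ^ (n - 1)) le_rfl⟩, ⟨_, mem j j 1 le_rfl⟩, Or.inl ?_,
    ⟨_, mem i j 1 hlt⟩, ?_⟩
  · apply Subtype.ext
    simp [Matrix.single_mul_single_of_ne, hij]
  · have hm : (⟨_, mem i i ((p : ZMod (p ^ n)) ^ (n - 1)) le_rfl⟩ * ⟨_, mem i j 1 hlt⟩ *
        ⟨_, mem j j 1 le_rfl⟩ : upperTriangularSubring n (ZMod (p ^ n))) =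
        ⟨_, mem i j ((p : ZMod (p ^ n)) ^ (n - 1)) hlt⟩ := by
      apply Subtype.ext
      simp
    rw [hm]
    have col : ∀ r : upperTriangularSubring n (ZMod (p ^ n)), ∀ a : Fin n, a ≠ i →
        r.1 a i = 0 := by
      intro r a ha
      refine r.2 ?_
      show i < a
      rw [Fin.lt_def]
      have : a.val ≠ 0 := fun h => ha (Fin.ext h)
      show 0 < a.val
      omega
    have hpow : ∀ (r : upperTriangularSubring n (ZMod (p ^ n))) (k : ℕ),
        (r ^ k).1 i i = (r.1 i i) ^ k := by
      intro r k
      induction k with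
      | zero => simp
      | succ k ih =>
        rw [pow_succ, pow_succ, ← ih]
        show ((r ^ k).1 * r.1) i i = _
        rw [Matrix.mul_apply, Finset.sum_eq_single i]
        · intro b _ hb
          rw [col r b hb, mul_zero]
        · simp
    have hz : ∀ r : upperTriangularSubring n (ZMod (p ^ n)),
        r • (⟨_, mem i j ((p : ZMod (p ^ n)) ^ (n - 1)) hlt⟩ :
          upperTriangularSubring n (ZMod (p ^ n))) = 0 ↔
        r.1 i i * (p : ZMod (p ^ n)) ^ (n - 1) = 0 := by
      intro r
      constructor
      · intro h
        have h' := congrFun (congrFun (congrArg Subtype.val h) i) j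
        simpa [smul_eq_mul] using h'
      · intro h
        apply Subtype.ext
        ext a b
        show (r.1 * Matrix.single i j ((p : ZMod (p ^ n)) ^ (n - 1))) a b = 0
        by_cases hb : b = j
        · subst hb
          rw [Matrix.mul_single_apply_same]
          by_cases ha : a = i
          · rw [ha, h]
          · rw [col r a ha, zero_mul]
        · rw [Matrix.mul_single_apply_of_ne]
          exact hb
    rintro (h | ⟨r, k, h0, h1⟩)
    · have h1 := (hz 1).1 (by rw [h, smul_zero])
      rw [key] at h1
      haveI : Fact (1 < p ^ n) := ⟨Nat.one_lt_pow (by omega) hp.one_lt⟩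
      simp [ZMod.val_one] at h1
      exact hp.one_lt.ne' h1
    · rw [hz, hpow] at h0
      exact h1 ((hz r).2 (key2 _ _ h0))
end

section
/- Let p be a prime and n ≥ 2 a natural number, and let T be the subring of Matrix (Fin n) (Fin n) (ZMod p) consisting of the upper triangular matrices (those A with A i j = 0 whenever j < i). Then T, regarded as a left module over itself, is not nil-semicommutative: there exist A, K ∈ T with A * K ∈ Nil_T(T) but A * L * K ∉ Nil_T(T) for some L ∈ T. -/
theorem upperTriangular_zmod_p_not_nilSemicommutative (p n : ℕ) (hp : p.Prime) (hn : 2 ≤ n) :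
    ∃ A K : upperTriangularSubring n (ZMod p),
      IsNilElem (upperTriangularSubring n (ZMod p)) (A * K) ∧
        ∃ L : upperTriangularSubring n (ZMod p),
          ¬ IsNilElem (upperTriangularSubring n (ZMod p)) (A * L * K) := by
  have : Fact p.Prime := ⟨hp⟩
  let a : Fin n := ⟨0, by omega⟩
  let b : Fin n := ⟨1, by omega⟩
  have hab : a ≠ b := by simp [a, b]
  have hle : a ≤ b := by simp [a, b]
  have mem : ∀ i j : Fin n, i ≤ j →
      Matrix.single i j (1 : ZMod p) ∈ upperTriangularSubring n (ZMod p) := by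
    intro i j hij x y hxy
    rw [Matrix.single_apply, if_neg]
    rintro ⟨rfl, rfl⟩
    exact absurd hij (not_le.mpr hxy)
  refine ⟨⟨_, mem a a le_rfl⟩, ⟨_, mem b b le_rfl⟩, Or.inl ?_, ⟨_, mem a b hle⟩, ?_⟩
  · apply Subtype.ext
    simp [hab]
  · have hm : (⟨_, mem a a le_rfl⟩ * ⟨_, mem a b hle⟩ * ⟨_, mem b b le_rfl⟩ :
        upperTriangularSubring n (ZMod p)) = ⟨_, mem a b hle⟩ := by
      apply Subtype.ext
      simp
    rw [hm]
    have key : ∀ r : Matrix (Fin n) (Fin n) (ZMod p), r.BlockTriangular id →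
        r * Matrix.single a b 1 = r a a • Matrix.single a b 1 := by
      intro r hr
      ext i j
      by_cases hj : j = b
      · subst hj
        by_cases hi : i = a
        · subst hi; simp
        · have : r i a = 0 := hr (by
            simp only [id, a, Fin.lt_def]
            have : i.val ≠ 0 := fun h => hi (Fin.ext h)
            omega)
          simp [this, Matrix.single_apply, Ne.symm hi]
      · simp [Matrix.single_apply, Matrix.mul_apply, Ne.symm hj]
    have keyp : ∀ r : Matrix (Fin n) (Fin n) (ZMod p), r.BlockTriangular id → ∀ k : ℕ,
        r ^ k * Matrix.single a b 1 = (r a a) ^ k • Matrix.single a b 1 := by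
      intro r hr k
      induction k with
      | zero => simp
      | succ k ih => rw [pow_succ, mul_assoc, key r hr, Matrix.mul_smul, ih, smul_smul, pow_succ']
    rintro (h | ⟨⟨r, hr⟩, k, h1, h2⟩)
    · have := congrFun (congrFun (congrArg Subtype.val h) a) b
      simp at this
    · have h1' : r ^ k * Matrix.single a b 1 = 0 := congrArg Subtype.val h1
      rw [keyp r hr] at h1'
      have h3 := congrFun (congrFun h1' a) b
      simp only [Matrix.smul_apply, Matrix.single_apply_same, Matrix.zero_apply, smul_eq_mul,
        mul_one] at h3
      have h4 : r a a = 0 := eq_zero_of_pow_eq_zero h3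
      apply h2
      apply Subtype.ext
      change r * Matrix.single a b 1 = 0
      rw [key r hr, h4, zero_smul]
end

section
/- Let D be a domain (a nontrivial ring with no nonzero zero divisors) and M a nil-semicommutative left D-module. Then the torsion set T(M) = { m ∈ M : r • m = 0 for some nonzero r ∈ D } is a submodule of M (it contains 0, is closed under addition, and is closed under scalar multiplication). -/
/-- A left `R`-module `M` is semicommutative if whenever `a • m = 0`,
one has `a • r • m = 0` for every `r : R`. -/
def IsSemicommutative (R M : Type*) [Ring R] [AddCommGroup M] [Module R M] : Prop :=
  ∀ (a : R) (m : M), a • m = 0 → ∀ r : R, a • r • m = 0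

/-- A left `R`-module `M` is weakly semicommutative if whenever `a • m = 0`,
`a • r • m` is a nilpotent element of `M` for every `r : R`. -/
def IsWeaklySemicommutative (R M : Type*) [Ring R] [AddCommGroup M] [Module R M] : Prop :=
  ∀ (a : R) (m : M), a • m = 0 → ∀ r : R, IsNilElem R (a • r • m)

theorem nilElem_torsion_aux {D M : Type*} [Ring D] [IsDomain D] [AddCommGroup M]
    [Module D M] {x : M} (hx : IsNilElem D x) : ∃ q : D, q ≠ 0 ∧ q • x = 0 := by
  rcases hx with rfl | ⟨t, k, h0, h1⟩
  · exact ⟨1, one_ne_zero, smul_zero _⟩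
  · refine ⟨t ^ k, pow_ne_zero _ ?_, h0⟩
    rintro rfl
    exact h1 (zero_smul _ _)

theorem torsion_set_is_submodule {D M : Type*} [Ring D] [IsDomain D] [AddCommGroup M]
    [Module D M] (h : IsNilSemicommutative D M) :
    ∃ N : Submodule D M, (N : Set M) = {m : M | ∃ r : D, r ≠ 0 ∧ r • m = 0} := by
  have key : ∀ (s : D) (n : M), s • n = 0 → ∀ r : D, ∃ q : D, q ≠ 0 ∧ q • s • r • n = 0 :=
    fun s n hs r => nilElem_torsion_aux (h s n (Or.inl hs) r)
  refine ⟨{ carrier := {m : M | ∃ r : D, r ≠ 0 ∧ r • m = 0}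
            zero_mem' := ⟨1, one_ne_zero, smul_zero _⟩
            add_mem' := ?_
            smul_mem' := ?_ }, rfl⟩
  · rintro m n ⟨r, hr, hrm⟩ ⟨s, hs, hsn⟩
    obtain ⟨q, hq, hqn⟩ := key s n hsn r
    refine ⟨q * (s * r), mul_ne_zero hq (mul_ne_zero hs hr), ?_⟩
    rw [mul_smul, mul_smul, smul_add, hrm, zero_add, hqn]
  · rintro c m ⟨r, hr, hrm⟩
    obtain ⟨q, hq, hqn⟩ := key r m hrm c
    exact ⟨q * r, mul_ne_zero hq hr, by rw [mul_smul, hqn]⟩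
end

section
/- Let φ : R → R' be a surjective ring homomorphism and let M be a left R'-module, regarded also as a left R-module via r • m = φ(r) • m (restriction of scalars along φ). Then M is a nil-semicommutative R'-module if and only if M is a nil-semicommutative R-module. -/
theorem nilSemicommutative_restrictScalars_iff {R R' M : Type*} [Ring R] [Ring R']
    [AddCommGroup M] [Module R' M] (φ : R →+* R') (hφ : Function.Surjective φ) :
    letI : Module R M := Module.compHom M φ
    (IsNilSemicommutative R' M ↔ IsNilSemicommutative R M) := by
  letI : Module R M := Module.compHom M φ
  have hs : ∀ (r : R) (m : M), r • m = φ r • m := fun _ _ => rfl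
  have hn : ∀ m : M, IsNilElem R m ↔ IsNilElem R' m := by
    intro m
    unfold IsNilElem
    simp only [hs, map_pow]
    exact or_congr Iff.rfl
      (hφ.exists (p := fun x : R' => ∃ k : ℕ, x ^ k • m = 0 ∧ x • m ≠ 0)).symm
  change IsNilSemicommutative R' M ↔ IsNilSemicommutative R M
  unfold IsNilSemicommutative
  simp only [hn, hs]
  constructor
  · intro h a m ha r
    exact h (φ a) m ha (φ r)
  · intro h a m ha r
    obtain ⟨a, rfl⟩ := hφ a
    obtain ⟨r, rfl⟩ := hφ r
    exact h a m ha r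
end

section
/- Let R be a commutative ring and M an R-module. Let M[x] denote the polynomial module (PolynomialModule R M) over the polynomial ring R[x], and realize the Laurent polynomial module M[x,x⁻¹] over R[x,x⁻¹] as the localization of M[x] at the submonoid of powers of x (so that R[x,x⁻¹] = Localization at the powers of x and M[x,x⁻¹] = LocalizedModule of M[x] at the powers of x). Then M[x] is a nil-semicommutative R[x]-module if and only if M[x,x⁻¹] is a nil-semicommutative R[x,x⁻¹]-module. -/
section
variable {A N : Type*} [CommRing A] [AddCommGroup N] [Module A N] {S : Submonoid A}

theorem aux_mk_eq_zero (hS : ∀ s ∈ S, ∀ n : N, s • n = 0 → n = 0) (n : N) (s : S) :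
    LocalizedModule.mk n s = 0 ↔ n = 0 := by
  constructor
  · intro h
    rw [← LocalizedModule.zero_mk (S := S) (M := N) 1, LocalizedModule.mk_eq] at h
    obtain ⟨u, hu⟩ := h
    rw [smul_zero, smul_zero, one_smul] at hu
    exact hS u u.2 n hu
  · rintro rfl
    exact LocalizedModule.zero_mk s

theorem aux_nil_iff (hS : ∀ s ∈ S, ∀ n : N, s • n = 0 → n = 0) (n : N) (s : S) :
    IsNilElem (Localization S) (LocalizedModule.mk n s) ↔ IsNilElem A n := by
  unfold IsNilElem
  rw [aux_mk_eq_zero hS]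
  refine or_congr Iff.rfl ?_
  constructor
  · rintro ⟨r, k, h1, h2⟩
    induction r using Localization.induction_on with
    | H y =>
      obtain ⟨p, t⟩ := y
      rw [Localization.mk_pow, LocalizedModule.mk_smul_mk, aux_mk_eq_zero hS] at h1
      rw [LocalizedModule.mk_smul_mk, Ne, aux_mk_eq_zero hS] at h2
      exact ⟨p, k, h1, h2⟩
  · rintro ⟨p, k, h1, h2⟩
    refine ⟨Localization.mk p 1, k, ?_, ?_⟩
    · rw [Localization.mk_pow, LocalizedModule.mk_smul_mk, aux_mk_eq_zero hS]
      exact h1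
    · rw [LocalizedModule.mk_smul_mk, Ne, aux_mk_eq_zero hS]
      exact h2

theorem aux_semi_iff (hS : ∀ s ∈ S, ∀ n : N, s • n = 0 → n = 0) :
    IsNilSemicommutative A N ↔
      IsNilSemicommutative (Localization S) (LocalizedModule S N) := by
  constructor
  · intro h a m ham r
    induction a using Localization.induction_on with
    | H a =>
    induction r using Localization.induction_on with
    | H r =>
    induction m using LocalizedModule.induction_on with
    | h m t =>
    rw [LocalizedModule.mk_smul_mk, aux_nil_iff hS] at ham
    rw [LocalizedModule.mk_smul_mk, LocalizedModule.mk_smul_mk, aux_nil_iff hS]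
    exact h _ _ ham _
  · intro h a m ham r
    have := h (Localization.mk a 1) (LocalizedModule.mk m 1)
      (by rw [LocalizedModule.mk_smul_mk, aux_nil_iff hS]; exact ham) (Localization.mk r 1)
    rw [LocalizedModule.mk_smul_mk, LocalizedModule.mk_smul_mk, aux_nil_iff hS] at this
    exact this
end

theorem nilSemicommutative_polynomialModule_iff_laurent {R : Type*} [CommRing R] {M : Type*}
    [AddCommGroup M] [Module R M] :
    IsNilSemicommutative (Polynomial R) (PolynomialModule R M) ↔
      IsNilSemicommutative
        (Localization (Submonoid.powers (Polynomial.X : Polynomial R)))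
        (LocalizedModule (Submonoid.powers (Polynomial.X : Polynomial R))
          (PolynomialModule R M)) := by
  apply aux_semi_iff
  rintro _ ⟨k, rfl⟩ n hn
  ext i
  have h := congrArg (fun f : PolynomialModule R M => f.coeff (i + k)) hn
  simpa [← Polynomial.monomial_one_right_eq_X_pow, PolynomialModule.monomial_smul_apply] using h
end

section
/- Let R be a ring and M a reduced left R-module, i.e., whenever a ∈ R and m ∈ M satisfy a^2 • m = 0, then a • (r • m) = 0 for every r ∈ R. Then M is a nil-semicommutative module. -/
theorem reduced_implies_nilSemicommutative {R M : Type*} [Ring R] [AddCommGroup M] [Module R M]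
    (hred : ∀ (a : R) (m : M), a ^ 2 • m = 0 → ∀ r : R, a • r • m = 0) :
    IsNilSemicommutative R M := by
  have key : ∀ (k : ℕ) (r : R) (m : M), r ^ k • m = 0 → r • m = 0 := by
    intro k
    induction k with
    | zero =>
      intro r m h
      have hm : m = 0 := by simpa using h
      rw [hm, smul_zero]
    | succ n ih =>
      intro r m h
      cases n with
      | zero => simpa using h
      | succ j =>
        apply ih r m
        have h2 : r ^ 2 • (r ^ j • m) = 0 := by
          rw [← mul_smul, ← pow_add, show 2 + j = j + 1 + 1 by omega]
          exact h
        have h3 := hred r (r ^ j • m) h2 1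
        rw [one_smul, ← mul_smul, ← pow_succ'] at h3
        exact h3
  intro a m h r
  left
  have ham : a • m = 0 := by
    rcases h with h | ⟨s, k, h1, h2⟩
    · exact h
    · exact absurd (key k s _ h1) h2
  apply hred
  rw [pow_two, mul_smul, ham, smul_zero]
end
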